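/- Let S be a conical refinement commutative monoid whose algebraic preorder is antisymmetric, which has general comparability, is Boolean-valued, and in which every element is the sum of a directly finite element and a purely infinite element. Let a ∈ S and let X be a nonempty subset of S, and set a + X = {a + x : x ∈ X}. Then: (1) if b is an infimum of X with respect to the algebraic preorder, then a + b is an infimum of a + X; (2) if b is a supremum of X, then a + b is a supremum of a + X. -/

import Mathlib

namespace PaperCDS

variable {M : Type*} [AddCommMonoid M]

/-- The algebraic preorder: `a ≤ b` iff `a + c = b` for some `c`. -/
def algLe (a b : M) : Prop := ∃ c : M, a + c = b

/-- `S` is conical if `a + b = 0` implies `a = 0` and `b = 0`. -/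
def Conical (M : Type*) [AddCommMonoid M] : Prop :=
  ∀ a b : M, a + b = 0 → a = 0 ∧ b = 0

/-- The refinement property. -/
def Refinement (M : Type*) [AddCommMonoid M] : Prop :=
  ∀ a₀ a₁ b₀ b₁ : M, a₀ + a₁ = b₀ + b₁ →
    ∃ c₀₀ c₀₁ c₁₀ c₁₁ : M,
      a₀ = c₀₀ + c₀₁ ∧ a₁ = c₁₀ + c₁₁ ∧ b₀ = c₀₀ + c₁₀ ∧ b₁ = c₀₁ + c₁₁

/-- Orthogonality: `a ⊥ b` iff the only `x` with `x ≤ a` and `x ≤ b` is `0`. -/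
def Orth (a b : M) : Prop := ∀ x : M, algLe x a → algLe x b → x = 0

/-- `X^⊥ = {s : s ⊥ x for all x ∈ X}`. -/
def perpSet (X : Set M) : Set M := {s : M | ∀ x ∈ X, Orth s x}

/-- An ideal: a nonempty subset `I` with `a + b ∈ I ↔ a ∈ I ∧ b ∈ I`. -/
def IsIdeal (I : Set M) : Prop :=
  I.Nonempty ∧ ∀ a b : M, a + b ∈ I ↔ a ∈ I ∧ b ∈ I

/-- An additive endomorphism. -/
def IsAddEndo (p : M → M) : Prop :=
  p 0 = 0 ∧ ∀ x y : M, p (x + y) = p x + p y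

/-- A projection: an additive endomorphism `p` such that every `x` can be written
`x = p x + y` with `y` orthogonal to every element of the range of `p`. -/
def IsProjection (p : M → M) : Prop :=
  IsAddEndo p ∧ ∀ x : M, ∃ y : M, x = p x + y ∧ ∀ s : M, Orth y (p s)

/-- A complementary pair of projections. -/
def ComplPair (p q : M → M) : Prop :=
  IsAddEndo p ∧ IsAddEndo q ∧
    ∀ x : M, p x + q x = x ∧ p (q x) = 0 ∧ q (p x) = 0

/-- General comparability. -/
def GenComp (M : Type*) [AddCommMonoid M] : Prop :=
  ∀ a b : M, ∃ p q : M → M, ComplPair p q ∧ algLe (p a) (p b) ∧ algLe (q b) (q a)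

/-- `S` is Boolean-valued. -/
def BoolValued (M : Type*) [AddCommMonoid M] : Prop :=
  ∀ a b : M, ∃ p q : M → M, ComplPair p q ∧ algLe (p a) (p b) ∧
    ∀ p' q' : M → M, ComplPair p' q' → algLe (p' a) (p' b) →
      ∀ x : M, algLe (p' x) (p x)

/-- Directly finite element. -/
def DirectlyFinite (c : M) : Prop := ∀ x : M, x + c = c → x = 0

/-- Purely infinite element. -/
def PurelyInfinite (c : M) : Prop := c + c = c

/-- `b` is an infimum of `X` for the algebraic preorder. -/
def IsInfOf (b : M) (X : Set M) : Prop :=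
  (∀ x ∈ X, algLe b x) ∧ ∀ y : M, (∀ x ∈ X, algLe y x) → algLe y b

/-- `b` is a supremum of `X` for the algebraic preorder. -/
def IsSupOf (b : M) (X : Set M) : Prop :=
  (∀ x ∈ X, algLe x b) ∧ ∀ y : M, (∀ x ∈ X, algLe x y) → algLe b y

/-- Antisymmetry of the algebraic preorder. -/
def Antisymm (M : Type*) [AddCommMonoid M] : Prop :=
  ∀ a b : M, algLe a b → algLe b a → a = b

/-- Axiom (M5): every element is the sum of a directly finite element and a
purely infinite element. -/
def AxiomM5 (M : Type*) [AddCommMonoid M] : Prop :=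
  ∀ a : M, ∃ x y : M, DirectlyFinite x ∧ PurelyInfinite y ∧ a = x + y

/-- Axiom (M2): every nonempty subset has an infimum. -/
def AxiomM2 (M : Type*) [AddCommMonoid M] : Prop :=
  ∀ X : Set M, X.Nonempty → ∃ b : M, IsInfOf b X

theorem algLe.trans' {a b c : M} (h₁ : algLe a b) (h₂ : algLe b c) : algLe a c := by
  obtain ⟨u, rfl⟩ := h₁
  obtain ⟨v, rfl⟩ := h₂
  exact ⟨u + v, (add_assoc a u v).symm⟩

theorem algLe_add_left (a b : M) : algLe b (a + b) := ⟨a, add_comm b a⟩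

theorem algLe_add_right (a b : M) : algLe a (a + b) := ⟨b, rfl⟩

theorem algLe.add' {a b c d : M} (h₁ : algLe a b) (h₂ : algLe c d) :
    algLe (a + c) (b + d) := by
  obtain ⟨u, rfl⟩ := h₁
  obtain ⟨v, rfl⟩ := h₂
  exact ⟨u + v, add_add_add_comm a c u v⟩

theorem algLe_refl (a : M) : algLe a a := ⟨0, add_zero a⟩

theorem IsAddEndo.algLe_map {p : M → M} (hp : IsAddEndo p) {a b : M} (h : algLe a b) :
    algLe (p a) (p b) := by
  obtain ⟨u, rfl⟩ := h
  exact ⟨p u, (hp.2 a u).symm⟩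

theorem ComplPair.symm {p q : M → M} (h : ComplPair p q) : ComplPair q p :=
  ⟨h.2.1, h.1, fun x => ⟨(add_comm _ _).trans (h.2.2 x).1, (h.2.2 x).2.2, (h.2.2 x).2.1⟩⟩

theorem ComplPair.add_eq {p q : M → M} (h : ComplPair p q) (x : M) : p x + q x = x :=
  (h.2.2 x).1

theorem ComplPair.algLe_self {p q : M → M} (h : ComplPair p q) (x : M) : algLe (p x) x :=
  ⟨q x, h.add_eq x⟩

theorem ComplPair.idem {p q : M → M} (h : ComplPair p q) (x : M) : p (p x) = p x := by
  have := h.add_eq (p x)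
  rwa [(h.2.2 x).2.2, add_zero] at this

theorem ComplPair.algLe_of {p q : M → M} (h : ComplPair p q) {a b : M}
    (hp : algLe (p a) (p b)) (hq : algLe (q a) (q b)) : algLe a b := by
  have := hp.add' hq
  rwa [h.add_eq, h.add_eq] at this

theorem DirectlyFinite.of_algLe {a b : M} (hb : DirectlyFinite b) (h : algLe a b) :
    DirectlyFinite a := by
  obtain ⟨u, rfl⟩ := h
  intro x hx
  exact hb x (by rw [← add_assoc, hx])

theorem DirectlyFinite.map_eq {f a b c : M} (hf : DirectlyFinite f) (hb : f = a + b)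
    (hc : f = a + c) {p q : M → M} (h : ComplPair p q) (hle : algLe (p b) (p c)) :
    p b = p c := by
  obtain ⟨e, he⟩ := hle
  have he0 : e = 0 := by
    apply hf.of_algLe (h.algLe_self f) e
    calc e + p f = p a + (p b + e) := by rw [hb, h.1.2]; abel
      _ = p f := by rw [he, hc, h.1.2]
  rw [← he, he0, add_zero]

/-- Directly finite elements are cancellable. -/
theorem DirectlyFinite.add_left_cancel' (hRef : Refinement M) (hGC : GenComp M) {f x y : M}
    (hf : DirectlyFinite f) (h : f + x = f + y) : x = y := by
  obtain ⟨a, b, c, d, h₁, rfl, h₂, rfl⟩ := hRef _ _ _ _ h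
  obtain ⟨p, q, hpq, hp, hq⟩ := hGC b c
  rw [← hpq.add_eq b, ← hpq.add_eq c, hf.map_eq h₁ h₂ hpq hp,
    hf.map_eq h₂ h₁ hpq.symm hq]

theorem DirectlyFinite.algLe_of_add (hRef : Refinement M) (hGC : GenComp M) {f x y : M}
    (hf : DirectlyFinite f) (h : algLe (f + x) (f + y)) : algLe x y := by
  obtain ⟨w, hw⟩ := h
  exact ⟨w, hf.add_left_cancel' hRef hGC (by rw [← add_assoc, hw])⟩

theorem IsInfOf.directlyFinite_add (hRef : Refinement M) (hGC : GenComp M) {f b : M} {X : Set M}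
    (hf : DirectlyFinite f) (h : IsInfOf b X) : IsInfOf (f + b) ((fun x => f + x) '' X) := by
  refine ⟨?_, fun y hy => ?_⟩
  · rintro _ ⟨x, hx, rfl⟩
    exact (algLe_refl f).add' (h.1 x hx)
  obtain ⟨p, q, hpq, hp, d, hd⟩ := hGC y f
  refine hpq.algLe_of (hp.trans' (hpq.1.algLe_map (algLe_add_right f b))) ?_
  have hdb : algLe d b := by
    refine h.2 d fun x hx => ?_
    refine algLe.trans' ?_ (hpq.symm.algLe_self x)
    refine (hf.of_algLe (hpq.symm.algLe_self f)).algLe_of_add hRef hGC ?_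
    rw [hd, ← hpq.2.1.2]
    exact hpq.2.1.algLe_map (hy _ ⟨x, hx, rfl⟩)
  rw [← hpq.symm.idem y, ← hd]
  exact hpq.2.1.algLe_map ((hpq.symm.algLe_self f).add' hdb)

theorem PurelyInfinite.map {p : M → M} (hp : IsAddEndo p) {i : M} (hi : PurelyInfinite i) :
    PurelyInfinite (p i) := by
  rw [PurelyInfinite, ← hp.2, hi]

theorem PurelyInfinite.add_eq {i y : M} (hi : PurelyInfinite i) (h : algLe i y) :
    i + y = y := by
  obtain ⟨w, rfl⟩ := h
  rw [← add_assoc, hi]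

theorem IsInfOf.purelyInfinite_add (hAnti : Antisymm M) (hGC : GenComp M) (hBV : BoolValued M)
    {i b : M} {X : Set M} (hi : PurelyInfinite i) (h : IsInfOf b X) :
    IsInfOf (i + b) ((fun x => i + x) '' X) := by
  refine ⟨?_, fun y hy => ?_⟩
  · rintro _ ⟨x, hx, rfl⟩
    exact (algLe_refl i).add' (h.1 x hx)
  obtain ⟨r, s, hrs, hr, hmax⟩ := hBV y (i + b)
  refine hrs.algLe_of hr ?_
  have hsb : algLe (s y) b := by
    refine h.2 _ fun x hx => ?_
    obtain ⟨t, t', ht, hxi, hix⟩ := hGC x i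
    have htr : ∀ z, algLe (t z) (r z) := by
      refine hmax t t' ht ?_
      have h₁ := ht.1.algLe_map (hy _ ⟨x, hx, rfl⟩)
      have h₂ := (algLe_refl (t i)).add' hxi
      rw [← ht.1.2, hi.map ht.1] at h₂
      exact (h₁.trans' h₂).trans' (ht.1.algLe_map (algLe_add_right i b))
    have hst : s (t i) = 0 := by
      have := hrs.2.1.algLe_map (htr i)
      rw [(hrs.2.2 i).2.2] at this
      exact hAnti _ _ this ⟨_, zero_add _⟩
    have hsi : algLe (s i) (s x) := by
      rw [← ht.add_eq i, hrs.2.1.2, hst, zero_add]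
      exact hrs.2.1.algLe_map (hix.trans' (ht.symm.algLe_self x))
    have hsy := hrs.2.1.algLe_map (hy _ ⟨x, hx, rfl⟩)
    rw [hrs.2.1.2, (hi.map hrs.2.1).add_eq hsi] at hsy
    exact hsy.trans' (hrs.symm.algLe_self x)
  rw [← hrs.symm.idem y]
  exact hrs.2.1.algLe_map (hsb.trans' (algLe_add_left i b))

theorem IsSupOf.directlyFinite_add (hRef : Refinement M) (hGC : GenComp M) {f b : M} {X : Set M}
    (hX : X.Nonempty) (hf : DirectlyFinite f) (h : IsSupOf b X) :
    IsSupOf (f + b) ((fun x => f + x) '' X) := by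
  refine ⟨?_, fun y hy => ?_⟩
  · rintro _ ⟨x, hx, rfl⟩
    exact (algLe_refl f).add' (h.1 x hx)
  obtain ⟨x₀, hx₀⟩ := hX
  obtain ⟨d, rfl⟩ := (algLe_add_right f x₀).trans' (hy _ ⟨x₀, hx₀, rfl⟩)
  exact (algLe_refl f).add' (h.2 d fun x hx => hf.algLe_of_add hRef hGC (hy _ ⟨x, hx, rfl⟩))

theorem IsSupOf.purelyInfinite_add {i b : M} {X : Set M}
    (hX : X.Nonempty) (hi : PurelyInfinite i) (h : IsSupOf b X) :
    IsSupOf (i + b) ((fun x => i + x) '' X) := by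
  refine ⟨?_, fun y hy => ?_⟩
  · rintro _ ⟨x, hx, rfl⟩
    exact (algLe_refl i).add' (h.1 x hx)
  obtain ⟨x₀, hx₀⟩ := hX
  have hiy := (algLe_add_right i x₀).trans' (hy _ ⟨x₀, hx₀, rfl⟩)
  have hby := h.2 y fun x hx => (algLe_add_left i x).trans' (hy _ ⟨x, hx, rfl⟩)
  rw [← hi.add_eq hiy]
  exact (algLe_refl i).add' hby

theorem statement14 (hCon : Conical M) (hRef : Refinement M)
    (hAnti : Antisymm M) (hGC : GenComp M) (hBV : BoolValued M)
    (hM5 : AxiomM5 M)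
    (a : M) (X : Set M) (hX : X.Nonempty) (b : M) :
    (IsInfOf b X → IsInfOf (a + b) ((fun x => a + x) '' X)) ∧
    (IsSupOf b X → IsSupOf (a + b) ((fun x => a + x) '' X)) := by
  obtain ⟨f, i, hf, hi, rfl⟩ := hM5 a
  have himage : (fun x => f + i + x) '' X = (fun x => f + x) '' ((fun x => i + x) '' X) := by
    simp only [Set.image_image, add_assoc]
  rw [himage, add_assoc]
  exact ⟨fun h => (h.purelyInfinite_add hAnti hGC hBV hi).directlyFinite_add hRef hGC hf,
    fun h => (h.purelyInfinite_add hX hi).directlyFinite_add hRef hGC (hX.image _) hf⟩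

end PaperCDS
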